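/- arXiv:1506.01092 — 4 statements merged into one kernel-verified Lean document; each statement's English description precedes it below -/
import Mathlib

section
/- Let d_w, d_v be positive integers, let w ∈ ℝ^{d_w} and v ∈ ℝ^{d_v} be independent random vectors with i.i.d. standard normal N(0,1) entries, and let b be uniform on [0, 2π], independent of (w, v). Then for any real d_w × d_v matrices X and Y, E[ 2·cos(wᵀ X v + b)·cos(wᵀ Y v + b) ] = det(I_{d_w} + (X−Y)(X−Y)ᵀ)^(−1/2) = κ_b(X−Y); that is, the expected inner product of the bilinear random Fourier features φ_{w,v}(Z) = √2·cos(wᵀ Z v + b) at X and Y equals κ_b(X−Y). -/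
open MeasureTheory ProbabilityTheory Matrix Real

/-- Standard Gaussian measure on ℝ^d (i.i.d. N(0,1) entries). -/
noncomputable def stdGaussian (d : ℕ) : Measure (Fin d → ℝ) :=
  Measure.pi fun _ => ProbabilityTheory.gaussianReal 0 1

/-- Uniform probability measure on the interval [a, b]. -/
noncomputable def unifIcc (a b : ℝ) : Measure ℝ :=
  (ENNReal.ofReal (b - a))⁻¹ • MeasureTheory.volume.restrict (Set.Icc a b)

/-- κ_b(A) = det(I + A Aᵀ)^(−1/2). -/
noncomputable def kb {dw dv : ℕ} (A : Matrix (Fin dw) (Fin dv) ℝ) : ℝ :=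
  (Matrix.det (1 + A * Aᵀ)) ^ (-(1 / 2 : ℝ))

/-- Gaussian kernel κ_g(A) = exp(−‖A‖_F²/2). -/
noncomputable def kg {dw dv : ℕ} (A : Matrix (Fin dw) (Fin dv) ℝ) : ℝ :=
  Real.exp (-(∑ i, ∑ j, (A i j) ^ 2) / 2)

/-- Binary quantizer sgn(z) = 1 if z ≥ 0, else 0. -/
noncomputable def sgn01 (z : ℝ) : ℝ := if 0 ≤ z then 1 else 0

instance stdG_prob (d : ℕ) : IsProbabilityMeasure (_root_.stdGaussian d) := by
  unfold _root_.stdGaussian; infer_instance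

instance unif_prob : IsProbabilityMeasure (unifIcc 0 (2 * π)) := by
  constructor
  unfold unifIcc
  simp only [sub_zero, Measure.smul_apply, Measure.restrict_apply_univ, Real.volume_Icc, smul_eq_mul]
  apply ENNReal.inv_mul_cancel
  · have := Real.pi_pos
    simp [this]
  · exact ENNReal.ofReal_ne_top

lemma unif_integral (s t : ℝ) :
    ∫ b, (Real.sqrt 2 * Real.cos (s + b)) * (Real.sqrt 2 * Real.cos (t + b)) ∂(unifIcc 0 (2 * π))
      = Real.cos (s - t) := by
  have hpi := Real.pi_pos
  have h : ∀ b : ℝ, (Real.sqrt 2 * Real.cos (s + b)) * (Real.sqrt 2 * Real.cos (t + b))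
      = Real.cos (s - t) + Real.cos (2 * b + (s + t)) := by
    intro b
    have h2 : Real.sqrt 2 * Real.sqrt 2 = 2 := Real.mul_self_sqrt (by norm_num)
    have e1 : s - t = (s + b) - (t + b) := by ring
    have e2 : 2 * b + (s + t) = (s + b) + (t + b) := by ring
    rw [e1, e2, Real.cos_sub (s + b) (t + b), Real.cos_add (s + b) (t + b)]
    linear_combination Real.cos (s + b) * Real.cos (t + b) * h2
  simp_rw [h]
  unfold unifIcc
  rw [integral_smul_measure, integral_Icc_eq_integral_Ioc,
    ← intervalIntegral.integral_of_le (by positivity),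
    intervalIntegral.integral_add (by simp) (by apply Continuous.intervalIntegrable; fun_prop)]
  have : ∫ b in (0:ℝ)..(2 * π), Real.cos (2 * b + (s + t)) = 0 := by
    rw [intervalIntegral.integral_comp_mul_add (f := Real.cos) (by norm_num), integral_cos]
    have : 2 * (2 * π) + (s + t) = (s + t) + (2 : ℕ) * (2 * π) := by push_cast; ring
    rw [this, Real.sin_add_nat_mul_two_pi]
    simp
  rw [this]
  simp [ENNReal.toReal_ofReal, hpi.le]
  field_simp

lemma gauss_cos {d : ℕ} (u : Fin d → ℝ) :
    ∫ v, Real.cos (u ⬝ᵥ v) ∂(_root_.stdGaussian d) = Real.exp (-(u ⬝ᵥ u) / 2) := by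
  have h := charFun_stdGaussian (WithLp.toLp 2 u : EuclideanSpace ℝ (Fin d))
  rw [← map_pi_eq_stdGaussian, charFun_apply, integral_map (by fun_prop) (by fun_prop)] at h
  have h2 := congrArg Complex.re h
  rw [← RCLike.re_eq_complex_re, ← integral_re] at h2
  · simp only [RCLike.re_eq_complex_re, Complex.exp_ofReal_mul_I_re] at h2
    unfold _root_.stdGaussian
    convert h2 using 1
    · simp [EuclideanSpace.inner_eq_star_dotProduct]
    · have e : (u ⬝ᵥ u) = ‖(WithLp.toLp 2 u : EuclideanSpace ℝ (Fin d))‖ ^ 2 := by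
        rw [EuclideanSpace.real_norm_sq_eq]
        simp [dotProduct, sq]
      rw [e, ← Complex.exp_ofReal_re]
      push_cast
      rfl
  · apply Integrable.of_bound (C := 1) (by fun_prop)
    exact ae_of_all _ fun x => by simp [Complex.norm_exp_ofReal_mul_I]

lemma gauss_1d (l : ℝ) (hl : 0 ≤ l) :
    ∫ x, Real.exp (-(l * x ^ 2) / 2) ∂(gaussianReal 0 1) = (1 + l) ^ (-(1 / 2 : ℝ)) := by
  rw [integral_gaussianReal_eq_integral_smul one_ne_zero]
  simp only [gaussianPDFReal, smul_eq_mul, mul_assoc, ← Real.exp_add]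
  rw [integral_const_mul]
  have : ∀ x : ℝ, -(x - 0) ^ 2 / (2 * ((1 : NNReal) : ℝ)) + -(l * x ^ 2) / 2
    = -((1 + l) / 2) * x ^ 2 := by intro x; simp; ring
  simp_rw [this, integral_gaussian]
  have hpi := Real.pi_pos
  have hl' : 0 < 1 + l := by linarith
  rw [Real.rpow_neg hl'.le, ← Real.sqrt_eq_rpow, ← Real.sqrt_inv, ← Real.sqrt_inv,
    ← Real.sqrt_mul (by positivity)]
  congr 1
  simp
  field_simp

lemma det_one_add {n : ℕ} (H : Matrix (Fin n) (Fin n) ℝ) (hH : H.IsHermitian) :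
    det (1 + H) = ∏ i, (1 + hH.eigenvalues i) := by
  have h := congrArg (Polynomial.eval (-1)) hH.charpoly_eq
  rw [Matrix.eval_charpoly, Polynomial.eval_prod] at h
  have e : Matrix.scalar (Fin n) (-1 : ℝ) - H = -(1 + H) := by
    rw [map_neg, map_one, neg_add']
  rw [e, Matrix.det_neg] at h
  simp only [Polynomial.eval_sub, Polynomial.eval_X, Polynomial.eval_C, ← neg_add',
     Finset.prod_neg] at h
  simpa using h

lemma gauss_quad {n : ℕ} (H : Matrix (Fin n) (Fin n) ℝ) (hH : H.PosSemidef) :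
    ∫ w, Real.exp (-(w ⬝ᵥ (H *ᵥ w)) / 2) ∂(_root_.stdGaussian n)
      = det (1 + H) ^ (-(1 / 2 : ℝ)) := by
  have hh := hH.isHermitian
  let b := hh.eigenvectorBasis
  let f : EuclideanSpace ℝ (Fin n) → ℝ := fun w => Real.exp (-(w.ofLp ⬝ᵥ (H *ᵥ w.ofLp)) / 2)
  have hf : Continuous f := by
    unfold f; fun_prop
  have e1 : ∫ w, f w ∂(ProbabilityTheory.stdGaussian (EuclideanSpace ℝ (Fin n))) =
      ∫ w, Real.exp (-(w ⬝ᵥ (H *ᵥ w)) / 2) ∂(_root_.stdGaussian n) := by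
    rw [← map_pi_eq_stdGaussian, integral_map (by fun_prop) (hf.aestronglyMeasurable)]
    rfl
  rw [← e1, stdGaussian_eq_map_pi_orthonormalBasis b, integral_map (Measurable.aemeasurable (by fun_prop))
    hf.aestronglyMeasurable]
  have e2 : ∀ x : Fin n → ℝ, f (∑ i, x i • b i) = 
      ∏ i, Real.exp (-(hh.eigenvalues i * x i ^ 2) / 2) := by
    intro x
    unfold f
    rw [← Real.exp_sum, ← Finset.sum_div, Finset.sum_neg_distrib]
    congr 3
    have hb : ∀ i j, (b i).ofLp ⬝ᵥ (b j).ofLp = if i = j then 1 else 0 := by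
      intro i j
      have := orthonormal_iff_ite.1 b.orthonormal j i
      simp [EuclideanSpace.inner_eq_star_dotProduct] at this
      rw [this]; simp [eq_comm]
    have hm : ∀ i, H *ᵥ (b i).ofLp = hh.eigenvalues i • (b i).ofLp :=
      hh.mulVec_eigenvectorBasis
    simp only [WithLp.ofLp_sum, WithLp.ofLp_smul, Matrix.mulVec_sum, Matrix.mulVec_smul, hm,
      sum_dotProduct, dotProduct_sum, smul_dotProduct, dotProduct_smul, hb]
    simp
    refine Finset.sum_congr rfl fun i _ => by ring
  simp_rw [e2]
  rw [integral_fintype_prod_eq_prod (f := fun i x => Real.exp (-(hh.eigenvalues i * x ^ 2) / 2))]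
  rw [det_one_add H hh, ← Real.finsetProd_rpow _ _ 
    (fun i _ => by have := hH.eigenvalues_nonneg i; positivity)]
  exact Finset.prod_congr rfl fun i _ => gauss_1d _ (hH.eigenvalues_nonneg i)

/-- Expected inner product of bilinear random Fourier features:
E[2 cos(wᵀXv+b) cos(wᵀYv+b)] = κ_b(X−Y). -/
theorem brff_inner_product {dw dv : ℕ} (hdw : 0 < dw) (hdv : 0 < dv)
    (X Y : Matrix (Fin dw) (Fin dv) ℝ) :
    (∫ p : (Fin dw → ℝ) × (Fin dv → ℝ) × ℝ,
        (Real.sqrt 2 * Real.cos (p.1 ⬝ᵥ (X *ᵥ p.2.1) + p.2.2)) *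
          (Real.sqrt 2 * Real.cos (p.1 ⬝ᵥ (Y *ᵥ p.2.1) + p.2.2))
        ∂((stdGaussian dw).prod ((stdGaussian dv).prod (unifIcc 0 (2 * π))))) =
      kb (X - Y) := by

  have hb : ∀ s t : ℝ, ‖(Real.sqrt 2 * Real.cos s) * (Real.sqrt 2 * Real.cos t)‖ ≤ 2 := by
    intro s t
    have h2 : Real.sqrt 2 * Real.sqrt 2 = 2 := Real.mul_self_sqrt (by norm_num)
    have : (Real.sqrt 2 * Real.cos s) * (Real.sqrt 2 * Real.cos t) =
      2 * (Real.cos s * Real.cos t) := by linear_combination Real.cos s * Real.cos t * h2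
    rw [this, norm_mul, norm_mul]
    have h3 : ‖Real.cos s‖ ≤ 1 := Real.abs_cos_le_one s
    have h4 : ‖Real.cos t‖ ≤ 1 := Real.abs_cos_le_one t
    have := mul_le_one₀ h3 (norm_nonneg _) h4
    norm_num
    simpa using this
  rw [integral_prod]
  · have e : ∀ w : Fin dw → ℝ, ∫ p : (Fin dv → ℝ) × ℝ,
        (Real.sqrt 2 * Real.cos (w ⬝ᵥ (X *ᵥ p.1) + p.2)) *
          (Real.sqrt 2 * Real.cos (w ⬝ᵥ (Y *ᵥ p.1) + p.2))
        ∂((_root_.stdGaussian dv).prod (unifIcc 0 (2 * π))) =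
        Real.exp (-(w ⬝ᵥ (((X - Y) * (X - Y)ᵀ) *ᵥ w)) / 2) := by
      intro w
      rw [integral_prod]
      · simp only [unif_integral]
        have : ∀ v : Fin dv → ℝ, w ⬝ᵥ (X *ᵥ v) - w ⬝ᵥ (Y *ᵥ v) = (w ᵥ* (X - Y)) ⬝ᵥ v := by
          intro v
          rw [← dotProduct_sub, ← Matrix.sub_mulVec, Matrix.dotProduct_mulVec]
        simp_rw [this, gauss_cos]
        rw [← Matrix.mulVec_mulVec, Matrix.mulVec_transpose, Matrix.dotProduct_mulVec w]
      · exact Integrable.of_bound (C := 2) (Continuous.aestronglyMeasurable (by fun_prop))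
          (ae_of_all _ fun p => hb _ _)
    simp only [e]
    rw [gauss_quad _ (by simpa using Matrix.posSemidef_self_mul_conjTranspose (X - Y))]
    rfl
  · exact Integrable.of_bound (C := 2) (Continuous.aestronglyMeasurable (by fun_prop))
      (ae_of_all _ fun p => hb _ _)
end

section
/- Let d_w, d_v be positive integers and let X, Y be real d_w × d_v matrices with ‖X‖_F ≤ 0.8 and ‖Y‖_F ≤ 0.8. Let Δ = (X−Y)(X−Y)ᵀ have eigenvalues λ_1 ≥ λ_2 ≥ … ≥ λ_{d_w} ≥ 0, and assume λ_1 ≤ 0.28·Σ_{i=2}^{d_w} λ_i. Then κ_g(X−Y) ≤ κ_b(X−Y) ≤ κ_g(X−Y)^{0.79}. -/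
open MeasureTheory ProbabilityTheory Matrix Real

lemma aux_exp {t : ℝ} (h0 : 0 ≤ t) (h1 : t ≤ 0.56) : Real.exp (0.79 * t) ≤ 1 + t := by
  have hc : Real.exp 0.4424 ≤ 1.56 := by
    have := Real.exp_bound' (x := 0.4424) (by norm_num) (by norm_num) (n := 5) (by norm_num)
    refine this.trans ?_
    norm_num [Finset.sum_range_succ, Nat.factorial]
  have ha : (0:ℝ) ≤ 1 - t / 0.56 := by
    linarith [(div_le_one (by norm_num : (0:ℝ) < 0.56)).2 h1]
  have hb : (0:ℝ) ≤ t / 0.56 := by positivity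
  have hcv := convexOn_exp.2 (Set.mem_univ (0:ℝ)) (Set.mem_univ (0.4424:ℝ)) ha hb (by ring)
  simp only [smul_eq_mul, Real.exp_zero, mul_zero, zero_add, mul_one] at hcv
  have e : t / 0.56 * 0.4424 = 0.79 * t := by ring
  rw [e] at hcv
  have : t / 0.56 * Real.exp 0.4424 ≤ t / 0.56 * 1.56 := by gcongr
  have e2 : 1 - t / 0.56 + t / 0.56 * 1.56 = 1 + t := by ring
  linarith

lemma aux_det {n : ℕ} {M : Matrix (Fin n) (Fin n) ℝ} (h : M.IsHermitian) :
    (1 + M).det = ∏ i, (1 + h.eigenvalues i) := by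
  have h1 := congrArg (Polynomial.eval (-1)) h.charpoly_eq
  rw [Matrix.eval_charpoly, Polynomial.eval_prod] at h1
  have e : Matrix.scalar (Fin n) (-1 : ℝ) - M = -(1 + M) := by
    rw [map_neg, map_one, neg_add, sub_eq_add_neg]
  rw [e, Matrix.det_neg] at h1
  have e2 : ∀ i, Polynomial.eval (-1 : ℝ)
      (Polynomial.X - Polynomial.C ((h.eigenvalues i : ℝ))) = -1 * (1 + h.eigenvalues i) := by
    intro i; simp; ring
  simp only [RCLike.ofReal_real_eq_id, id] at h1
  simp only [e2, Finset.prod_mul_distrib, Finset.prod_const, Finset.card_univ] at h1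
  exact mul_left_cancel₀ (pow_ne_zero _ (by norm_num)) h1

/-- Lemma 1: under the norm and eigenvalue assumptions,
κ_g(X−Y) ≤ κ_b(X−Y) ≤ κ_g(X−Y)^0.79. -/
theorem kb_bounds {dw dv : ℕ} (hdw : 0 < dw) (hdv : 0 < dv)
    (X Y : Matrix (Fin dw) (Fin dv) ℝ)
    (hX : Real.sqrt (∑ i, ∑ j, (X i j) ^ 2) ≤ 0.8)
    (hY : Real.sqrt (∑ i, ∑ j, (Y i j) ^ 2) ≤ 0.8)
    (hpsd : ((X - Y) * (X - Y)ᵀ).PosSemidef)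
    -- λ₁ ≤ 0.28 · Σ_{i=2}^{d_w} λ_i : the largest eigenvalue is at most
    -- 0.28 times the sum of the remaining eigenvalues
    (heig : ∃ i0 : Fin dw, (∀ i, hpsd.1.eigenvalues i ≤ hpsd.1.eigenvalues i0) ∧
      hpsd.1.eigenvalues i0 ≤ 0.28 * ∑ i ∈ Finset.univ.erase i0, hpsd.1.eigenvalues i) :
    kg (X - Y) ≤ kb (X - Y) ∧ kb (X - Y) ≤ (kg (X - Y)) ^ (0.79 : ℝ) := by
  have htr : ∑ i, ∑ j, ((X - Y) i j) ^ 2 = ∑ i, hpsd.1.eigenvalues i := by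
    have := hpsd.1.trace_eq_sum_eigenvalues
    simp only [RCLike.ofReal_real_eq_id, id] at this
    rw [← this]
    simp [Matrix.trace, Matrix.mul_apply, sq]
  have hS : ∑ i, ∑ j, ((X - Y) i j) ^ 2 ≤ 2.56 := by
    rw [Real.sqrt_le_left (by norm_num)] at hX hY
    have : ∑ i, ∑ j, ((X - Y) i j) ^ 2 ≤ ∑ i, ∑ j, (2 * (X i j) ^ 2 + 2 * (Y i j) ^ 2) := by
      gcongr with i _ j _
      rw [Matrix.sub_apply]
      nlinarith [sq_nonneg (X i j + Y i j)]
    simp only [Finset.sum_add_distrib, ← Finset.mul_sum] at this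
    norm_num at hX hY ⊢
    norm_num at this
    linarith
  have hdet := aux_det hpsd.1
  have hnn : ∀ i, 0 ≤ hpsd.1.eigenvalues i := hpsd.eigenvalues_nonneg
  unfold kg kb
  rw [htr] at hS ⊢
  rw [hdet]
  generalize hpsd.1.eigenvalues = l at *
  obtain ⟨i0, hmax, hi0⟩ := heig
  have hs := Finset.add_sum_erase Finset.univ l (Finset.mem_univ i0)
  have hle : ∀ i, l i ≤ 0.56 := by
    intro i
    have := hmax i
    norm_num at *
    linarith
  have hpos : 0 < ∏ i, (1 + l i) := Finset.prod_pos fun i _ => by linarith [hnn i]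
  have hup : ∏ i, (1 + l i) ≤ Real.exp (∑ i, l i) := by
    rw [Real.exp_sum]
    exact Finset.prod_le_prod (fun i _ => by linarith [hnn i])
      (fun i _ => by linarith [Real.add_one_le_exp (l i)])
  have hlo : Real.exp (0.79 * ∑ i, l i) ≤ ∏ i, (1 + l i) := by
    rw [Finset.mul_sum, Real.exp_sum]
    exact Finset.prod_le_prod (fun i _ => (Real.exp_pos _).le)
      (fun i _ => aux_exp (hnn i) (hle i))
  constructor
  · have := Real.rpow_le_rpow_of_nonpos hpos hup (by norm_num : -(1 / 2 : ℝ) ≤ 0)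
    rw [← Real.exp_mul] at this
    convert this using 2
    ring
  · have := Real.rpow_le_rpow_of_nonpos (Real.exp_pos _) hlo (by norm_num : -(1 / 2 : ℝ) ≤ 0)
    rw [← Real.exp_mul] at this ⊢
    convert this using 2
    ring
end

section
/- Let d_w, d_v be positive integers and let X, Y be real d_w × d_v matrices. Then P(h(X) ≠ h(Y)) ≤ min{ (1/2)·√(1 − κ_g(X−Y)), (4/π²)·(1 − (2/3)·κ_g(X−Y)) }, where the probability is over (w, v, b, t). -/
open MeasureTheory ProbabilityTheory Matrix Real

/-- Joint law of (w, v, b, t): w ~ N(0, I_{d_w}), v ~ N(0, I_{d_v}),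
b ~ Unif[0, 2π], t ~ Unif[−1, 1], mutually independent. -/
noncomputable def hashLaw (dw dv : ℕ) :
    Measure ((Fin dw → ℝ) × (Fin dv → ℝ) × ℝ × ℝ) :=
  (stdGaussian dw).prod ((stdGaussian dv).prod ((unifIcc 0 (2 * π)).prod (unifIcc (-1) 1)))

/-- The hash bit h(X) = sgn(cos(wᵀ X v + b) + t) as a function of (w, v, b, t). -/
noncomputable def hashBit {dw dv : ℕ} (X : Matrix (Fin dw) (Fin dv) ℝ)
    (p : (Fin dw → ℝ) × (Fin dv → ℝ) × ℝ × ℝ) : ℝ :=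
  sgn01 (Real.cos (p.1 ⬝ᵥ (X *ᵥ p.2.1) + p.2.2.1) + p.2.2.2)


lemma aux_summable : Summable (fun n : ℤ => 2 / π / (1 - 4 * (n:ℝ) ^ 2)) := by
  have h := (Real.summable_one_div_int_pow (p := 2)).2 (by norm_num)
  have h2 : Summable (fun n : ℤ => 1 / (1 - 4 * (n:ℝ) ^ 2)) := by
    refine Summable.of_norm_bounded_eventually h ?_
    have : ({0}ᶜ : Set ℤ) ∈ Filter.cofinite := by
      rw [Filter.mem_cofinite]; simp
    filter_upwards [this] with n hn
    have hn0 : n ≠ 0 := hn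
    have h1 : (1:ℝ) ≤ (n:ℝ) ^ 2 := by
      have : (1:ℤ) ≤ n ^ 2 := by
        have := sq_pos_of_ne_zero hn0
        omega
      exact_mod_cast this
    rw [Real.norm_eq_abs, abs_div, abs_one, abs_of_neg (by linarith)]
    apply one_div_le_one_div_of_le <;> linarith
  have := h2.mul_left (2 / π)
  refine this.congr ?_
  intro n
  ring

lemma aux_integral (n : ℤ) :
    ∫ x in (0:ℝ)..π, Complex.exp (-2 * Complex.I * n * x) * (Complex.sin x) =
      2 / (1 - 4 * (n:ℂ) ^ 2) := by
  have hne : (1 - 4 * (n:ℂ) ^ 2) ≠ 0 := by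
    intro h
    have : (1 - 4 * n ^ 2 : ℤ) = 0 := by exact_mod_cast h
    omega
  have hd : ∀ x : ℝ, HasDerivAt (fun y : ℝ => Complex.exp (-2 * Complex.I * n * y) *
      ((-2 * Complex.I * n) * Complex.sin y - Complex.cos y) / (1 - 4 * (n:ℂ) ^ 2))
      (Complex.exp (-2 * Complex.I * n * x) * (Complex.sin x)) x := by
    intro x
    have : HasDerivAt (fun y : ℂ => Complex.exp (-2 * Complex.I * n * y) *
      ((-2 * Complex.I * n) * Complex.sin y - Complex.cos y) / (1 - 4 * (n:ℂ) ^ 2))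
      (Complex.exp (-2 * Complex.I * n * x) * (Complex.sin x)) x := by
      have h1 := (((hasDerivAt_id (x:ℂ)).const_mul (-2 * Complex.I * n)).cexp.mul
        (((Complex.hasDerivAt_sin x).const_mul (-2 * Complex.I * n)).sub
          (Complex.hasDerivAt_cos x))).div_const (1 - 4 * (n:ℂ) ^ 2)
      refine h1.congr_deriv ?_
      rw [div_eq_iff hne]
      simp only [id, Pi.sub_apply]
      ring_nf
      rw [Complex.I_sq]
      ring
    exact this.comp_ofReal
  rw [intervalIntegral.integral_eq_sub_of_hasDerivAt (fun x _ => hd x)]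
  · have : Complex.exp (-2 * Complex.I * n * (π:ℝ)) = 1 := by
      rw [Complex.exp_eq_one_iff]
      exact ⟨-n, by push_cast; ring⟩
    rw [this]
    simp
    ring
  · apply Continuous.intervalIntegrable
    fun_prop

lemma aux_fourier (x : ℝ) :
    HasSum (fun n : ℤ => 2 / π / (1 - 4 * (n:ℝ) ^ 2) * Real.cos (2 * n * x)) |Real.sin x| := by
  haveI : Fact (0 < π) := ⟨Real.pi_pos⟩
  have hper : Function.Periodic (fun x : ℝ => ((|Real.sin x| : ℝ) : ℂ)) π := by
    intro x
    simp [Real.sin_add_pi]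
  have hcont : Continuous (hper.lift : AddCircle π → ℂ) :=
    Continuous.quotient_lift (by fun_prop) _
  let f : C(AddCircle π, ℂ) := ⟨hper.lift, hcont⟩
  have hf : ∀ x : ℝ, f (x : AddCircle π) = ((|Real.sin x| : ℝ) : ℂ) := fun x => rfl
  have hc : ∀ n : ℤ, fourierCoeff f n = ((2 / π / (1 - 4 * (n:ℝ) ^ 2) : ℝ) : ℂ) := by
    intro n
    rw [fourierCoeff_eq_intervalIntegral _ _ 0]
    have : ∫ x in (0:ℝ)..0+π, (fourier (-n) (x : AddCircle π)) • f (x : AddCircle π) =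
       ∫ x in (0:ℝ)..π, Complex.exp (-2 * Complex.I * n * x) * (Complex.sin x) := by
      rw [zero_add]
      apply intervalIntegral.integral_congr
      intro x hx
      rw [Set.uIcc_of_le Real.pi_pos.le] at hx
      simp only [hf, fourier_coe_apply, smul_eq_mul]
      rw [abs_of_nonneg (Real.sin_nonneg_of_nonneg_of_le_pi hx.1 hx.2)]
      have hpi : (π : ℂ) ≠ 0 := by exact_mod_cast Real.pi_ne_zero
      congr 1
      · congr 1
        push_cast
        field_simp
      · simp
    rw [this, aux_integral]
    simp only [Complex.real_smul]
    push_cast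
    ring
  have hs : Summable (fourierCoeff f) := by
    have : Summable (fun n : ℤ => ((2 / π / (1 - 4 * (n:ℝ) ^ 2) : ℝ) : ℂ)) :=
      Complex.ofRealCLM.summable aux_summable
    exact this.congr (fun n => (hc n).symm)
  have h := has_pointwise_sum_fourier_series_of_summable hs (x : AddCircle π)
  have h2 := Complex.reCLM.hasSum h
  rw [hf] at h2
  change HasSum _ |Real.sin x| at h2
  convert h2 using 1
  funext n
  simp only [Complex.reCLM_apply]
  rw [hc, fourier_coe_apply, smul_eq_mul, Complex.re_ofReal_mul]
  congr 1
  have hpi : (π : ℂ) ≠ 0 := by exact_mod_cast Real.pi_ne_zero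
  have : (2 * (π:ℂ) * Complex.I * n * x / (π:ℝ)) = ((2 * n * x : ℝ) : ℂ) * Complex.I := by
    push_cast
    field_simp
  rw [this, Complex.exp_ofReal_mul_I_re]

lemma aux_mean {Ω : Type*} [MeasurableSpace Ω] (μ : Measure Ω) [IsProbabilityMeasure μ]
    (D : Ω → ℝ) (hD : Measurable D) (hpos : ∀ n : ℤ, 0 ≤ ∫ ω, Real.cos (n * D ω) ∂μ) :
    ∫ ω, |Real.sin (D ω / 2)| ∂μ ≤ 2 / π * (1 - 2 / 3 * ∫ ω, Real.cos (D ω) ∂μ) := by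
  let F : ℤ → Ω → ℝ := fun n ω => 2 / π / (1 - 4 * (n:ℝ) ^ 2) * Real.cos (n * D ω)
  have hb : ∀ n ω, ‖F n ω‖ ≤ ‖2 / π / (1 - 4 * (n:ℝ) ^ 2)‖ := by
    intro n ω
    simp only [F, norm_mul]
    have := Real.abs_cos_le_one (n * D ω)
    exact mul_le_of_le_one_right (norm_nonneg _) this
  have hi : ∀ n, Integrable (F n) μ := by
    intro n
    refine Integrable.of_bound (C := ‖2 / π / (1 - 4 * (n:ℝ) ^ 2)‖) ?_ (ae_of_all _ (hb n))
    exact Measurable.aestronglyMeasurable (by fun_prop)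
  have hs : Summable (fun n => ∫ ω, ‖F n ω‖ ∂μ) := by
    refine Summable.of_nonneg_of_le (fun n => integral_nonneg (fun ω => norm_nonneg _)) ?_
      aux_summable.norm
    intro n
    calc ∫ ω, ‖F n ω‖ ∂μ ≤ ∫ ω, ‖2 / π / (1 - 4 * (n:ℝ) ^ 2)‖ ∂μ :=
          integral_mono (hi n).norm (integrable_const _) (hb n)
      _ = _ := by simp
  have h := hasSum_integral_of_summable_integral_norm hi hs
  have he : ∀ ω, ∑' n, F n ω = |Real.sin (D ω / 2)| := by
    intro ω
    rw [← (aux_fourier (D ω / 2)).tsum_eq]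
    congr 1; ext n
    simp only [F]
    congr 2; ring
  simp only [he] at h
  have h2 : ∀ n, ∫ ω, F n ω ∂μ = 2 / π / (1 - 4 * (n:ℝ) ^ 2) * ∫ ω, Real.cos (n * D ω) ∂μ :=
    fun n => integral_const_mul _ _
  have h3 := sum_le_hasSum ({-1, 0, 1} : Finset ℤ) (f := fun n => - ∫ ω, F n ω ∂μ) ?_ h.neg
  · simp only [h2] at h3
    rw [Finset.sum_insert (by decide), Finset.sum_insert (by decide), Finset.sum_singleton] at h3
    simp at h3
    have : (2:ℝ) / π * (1 - 2 / 3 * ∫ ω, Real.cos (D ω) ∂μ) = 2/π + 2 * (2 / π / (1-4)) *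
      ∫ ω, Real.cos (D ω) ∂μ := by ring
    rw [this]
    linarith
  · intro n hn
    rw [h2, neg_nonneg]
    apply mul_nonpos_of_nonpos_of_nonneg _ (hpos n)
    apply div_nonpos_of_nonneg_of_nonpos (by positivity)
    have hn0 : n ≠ 0 := by rintro rfl; simp at hn
    have h1 : (1:ℝ) ≤ (n:ℝ) ^ 2 := by
      have : (1:ℤ) ≤ n ^ 2 := by
        have := sq_pos_of_ne_zero hn0
        omega
      exact_mod_cast this
    linarith

lemma aux_mean2 {Ω : Type*} [MeasurableSpace Ω] (μ : Measure Ω) [IsProbabilityMeasure μ]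
    (D : Ω → ℝ) (hD : Measurable D) :
    ∫ ω, |Real.sin (D ω / 2)| ∂μ ≤ Real.sqrt ((1 - ∫ ω, Real.cos (D ω) ∂μ) / 2) := by
  have hi : Integrable (fun ω => |Real.sin (D ω / 2)|) μ := by
    refine Integrable.of_bound (C := 1) (Measurable.aestronglyMeasurable (by fun_prop))
      (ae_of_all _ fun ω => ?_)
    simpa using Real.abs_sin_le_one _
  have hc : Integrable (fun ω => Real.cos (D ω)) μ := by
    refine Integrable.of_bound (C := 1) (Measurable.aestronglyMeasurable (by fun_prop))
      (ae_of_all _ fun ω => ?_)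
    simpa using Real.abs_cos_le_one _
  apply Real.le_sqrt_of_sq_le
  set m := ∫ ω, |Real.sin (D ω / 2)| ∂μ with hm
  have h1 : ∫ ω, (2 * m * |Real.sin (D ω / 2)| - m ^ 2) ∂μ ≤ ∫ ω, (1 - Real.cos (D ω)) / 2 ∂μ := by
    apply integral_mono
    · exact (hi.const_mul _).sub (integrable_const _)
    · exact ((integrable_const _).sub hc).div_const _
    · intro ω
      have : Real.cos (D ω) = 1 - 2 * |Real.sin (D ω / 2)| ^ 2 := by
        rw [sq_abs]
        have h := Real.cos_two_mul (D ω / 2)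
        have h' := Real.sin_sq_add_cos_sq (D ω / 2)
        rw [show 2 * (D ω / 2) = D ω by ring] at h
        linarith
      simp only
      rw [this]
      nlinarith [sq_nonneg (m - |Real.sin (D ω / 2)|)]
  rw [integral_sub (hi.const_mul _) (integrable_const _), integral_const_mul, integral_div,
    integral_sub (integrable_const _) hc, ← hm] at h1
  simp at h1
  nlinarith

instance aux_inst (d : ℕ) : IsProbabilityMeasure (_root_.stdGaussian d) := by
  unfold _root_.stdGaussian; infer_instance

lemma aux_unif_prob (a b : ℝ) (h : a < b) : IsProbabilityMeasure (unifIcc a b) := by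
  constructor
  simp only [unifIcc, Measure.smul_apply, Measure.restrict_apply MeasurableSet.univ, Set.univ_inter,
    Real.volume_Icc, smul_eq_mul]
  apply ENNReal.inv_mul_cancel <;> simp [h]

lemma aux_cos (d : ℕ) (u : Fin d → ℝ) :
    ∫ w, Real.cos (w ⬝ᵥ u) ∂(_root_.stdGaussian d) = Real.exp (-(∑ i, u i ^ 2) / 2) := by
  have h : ∫ w, Complex.exp (((w ⬝ᵥ u : ℝ) : ℂ) * Complex.I) ∂(_root_.stdGaussian d) =
      ((Real.exp (-(∑ i, u i ^ 2) / 2) : ℝ) : ℂ) := by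
    have : ∀ w : Fin d → ℝ, Complex.exp (((w ⬝ᵥ u : ℝ) : ℂ) * Complex.I) =
        ∏ i, Complex.exp ((u i : ℂ) * (w i : ℂ) * Complex.I) := by
      intro w
      rw [← Complex.exp_sum, dotProduct, ← Finset.sum_mul]
      push_cast
      congr 2
      exact Finset.sum_congr rfl (fun i _ => mul_comm _ _)
    simp_rw [this]
    unfold _root_.stdGaussian
    rw [integral_fintype_prod_eq_prod
      (f := fun i (x : ℝ) => Complex.exp ((u i : ℂ) * (x : ℂ) * Complex.I))]
    simp_rw [← charFun_apply_real, charFun_gaussianReal]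
    rw [← Complex.exp_sum]
    push_cast
    congr 1
    simp [neg_div, Finset.sum_div]
  have h2 := congrArg Complex.re h
  rw [Complex.ofReal_re, ← RCLike.re_eq_complex_re, ← integral_re] at h2
  · rw [← h2]
    congr 1; ext w
    rw [RCLike.re_eq_complex_re, Complex.exp_ofReal_mul_I_re]
  · refine Integrable.of_bound (C := 1) ?_ (ae_of_all _ fun w => ?_)
    · apply Continuous.aestronglyMeasurable
      unfold dotProduct
      fun_prop
    · rw [Complex.norm_exp_ofReal_mul_I]

lemma aux_sq (d : ℕ) (a : Fin d → ℝ) :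
    Integrable (fun v : Fin d → ℝ => (∑ j, a j * v j) ^ 2) (_root_.stdGaussian d) ∧
    ∫ v, (∑ j, a j * v j) ^ 2 ∂(_root_.stdGaussian d) = ∑ j, a j ^ 2 := by
  have hm : ∀ j, MemLp (fun x : ℝ => a j * x) 2 (gaussianReal 0 1) := fun j =>
    (memLp_id_gaussianReal (μ := 0) (v := 1) 2).const_mul (a j)
  have hm1 : ∀ j, MemLp (fun v : Fin d → ℝ => a j * v j) 2 (_root_.stdGaussian d) := fun j =>
    (hm j).comp_measurePreserving (measurePreserving_eval (fun _ : Fin d => gaussianReal 0 1) j)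
  have hm2 : MemLp (fun v : Fin d → ℝ => ∑ j, a j * v j) 2 (_root_.stdGaussian d) :=
    memLp_finsetSum _ (fun j _ => hm1 j)
  refine ⟨hm2.integrable_sq, ?_⟩
  have hv := variance_sum_pi (μ := fun _ : Fin d => gaussianReal 0 1)
    (X := fun j x => a j * x) hm
  have hz : ∫ v, (∑ j, a j * v j) ∂(_root_.stdGaussian d) = 0 := by
    rw [integral_finsetSum _ (fun j _ => (hm1 j).integrable (by norm_num))]
    apply Finset.sum_eq_zero
    intro j _
    rw [integral_const_mul]
    have := integral_map_of_stronglyMeasurable (μ := _root_.stdGaussian d)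
      (measurable_pi_apply j) (f := fun x : ℝ => x) stronglyMeasurable_id
    rw [← this]
    unfold _root_.stdGaussian
    rw [(measurePreserving_eval (fun _ : Fin d => gaussianReal 0 1) j).map_eq]
    simp
  have he : (∑ j, fun v : Fin d → ℝ => a j * v j) = fun v => ∑ j, a j * v j := by
    ext v; simp
  rw [he] at hv
  change Var[_; _root_.stdGaussian d] = _ at hv
  rw [variance_of_integral_eq_zero hm2.aemeasurable hz] at hv
  rw [hv]
  apply Finset.sum_congr rfl
  intro j _
  rw [variance_const_mul]
  have := variance_id_gaussianReal (μ := 0) (v := 1)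
  have h' : Var[fun x : ℝ => x; gaussianReal 0 1] = 1 := by simpa using this
  rw [h']; simp

lemma aux_kg {dw dv : ℕ} (A : Matrix (Fin dw) (Fin dv) ℝ) :
    kg A ≤ ∫ p, Real.cos (p.1 ⬝ᵥ (A *ᵥ p.2))
      ∂((_root_.stdGaussian dw).prod (_root_.stdGaussian dv)) := by
  have hmeas : Measurable (fun p : (Fin dw → ℝ) × (Fin dv → ℝ) => p.1 ⬝ᵥ (A *ᵥ p.2)) := by
    unfold dotProduct Matrix.mulVec dotProduct
    fun_prop
  have hi : Integrable (fun p : (Fin dw → ℝ) × (Fin dv → ℝ) => Real.cos (p.1 ⬝ᵥ (A *ᵥ p.2)))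
      ((_root_.stdGaussian dw).prod (_root_.stdGaussian dv)) := by
    refine Integrable.of_bound (C := 1)
      (Measurable.aestronglyMeasurable (Real.measurable_cos.comp hmeas)) (ae_of_all _ fun ω => ?_)
    simpa using Real.abs_cos_le_one _
  rw [integral_prod_symm _ hi]
  simp only [aux_cos]
  have hq : ∀ i, Integrable (fun v : Fin dv → ℝ => ((A *ᵥ v) i) ^ 2) (_root_.stdGaussian dv) :=
    fun i => (aux_sq dv (A i)).1
  have hq2 : Integrable (fun v : Fin dv → ℝ => ∑ i, ((A *ᵥ v) i) ^ 2) (_root_.stdGaussian dv) :=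
    integrable_finsetSum _ (fun i _ => hq i)
  have hq3 : ∫ v, ∑ i, ((A *ᵥ v) i) ^ 2 ∂(_root_.stdGaussian dv) = ∑ i, ∑ j, (A i j) ^ 2 := by
    rw [integral_finsetSum _ (fun i _ => hq i)]
    exact Finset.sum_congr rfl (fun i _ => (aux_sq dv (A i)).2)
  set S := ∑ i, ∑ j, (A i j) ^ 2 with hS
  have hexp : Integrable (fun v : Fin dv → ℝ => Real.exp (-(∑ i, ((A *ᵥ v) i) ^ 2) / 2))
      (_root_.stdGaussian dv) := by
    refine Integrable.of_bound (C := 1) ?_ (ae_of_all _ fun v => ?_)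
    · apply Measurable.aestronglyMeasurable
      unfold Matrix.mulVec dotProduct
      fun_prop
    · rw [Real.norm_eq_abs, Real.abs_exp, Real.exp_le_one_iff]
      have : 0 ≤ ∑ i, ((A *ᵥ v) i) ^ 2 := Finset.sum_nonneg (fun i _ => sq_nonneg _)
      linarith
  have hk : kg A = Real.exp (-S / 2) := rfl
  have hii : Integrable (fun v : Fin dv → ℝ => Real.exp (-S / 2) *
      (1 + S / 2 - 1 / 2 * (∑ i, ((A *ᵥ v) i) ^ 2))) (_root_.stdGaussian dv) :=
    ((integrable_const _).sub (hq2.const_mul _)).const_mul _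
  calc kg A = ∫ v, Real.exp (-S / 2) *
      (1 + S / 2 - 1 / 2 * (∑ i, ((A *ᵥ v) i) ^ 2)) ∂(_root_.stdGaussian dv) := by
        rw [integral_const_mul, integral_sub (integrable_const _) (hq2.const_mul _),
          integral_const_mul, hq3, hk]
        simp
        ring
    _ ≤ _ := by
        apply integral_mono hii hexp
        intro v
        simp only
        set q := ∑ i, ((A *ᵥ v) i) ^ 2
        have : Real.exp (-q / 2) = Real.exp (-S / 2) * Real.exp (S / 2 - q / 2) := by
          rw [← Real.exp_add]; congr 1; ring
        rw [this]
        apply mul_le_mul_of_nonneg_left _ (Real.exp_pos _).le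
        have := Real.add_one_le_exp (S / 2 - q / 2)
        linarith

lemma aux_t (p q : ℝ) (hp : |p| ≤ 1) (hq : |q| ≤ 1) :
    unifIcc (-1) 1 {t | sgn01 (p + t) ≠ sgn01 (q + t)} = ENNReal.ofReal (|p - q| / 2) := by
  wlog h : p ≤ q generalizing p q
  · have := this q p hq hp (by linarith)
    rw [abs_sub_comm] at this
    rw [← this]
    congr 1; ext t; exact ne_comm
  have hs : {t | sgn01 (p + t) ≠ sgn01 (q + t)} = Set.Ico (-q) (-p) := by
    ext t
    simp only [Set.mem_setOf_eq, sgn01, Set.mem_Ico]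
    split_ifs with h1 h2 h2
    · simp; intro; linarith
    · exfalso; linarith
    · simp; constructor <;> linarith
    · simp; intro; linarith
  rw [abs_le] at hp hq
  rw [hs, unifIcc, Measure.smul_apply, Measure.restrict_apply measurableSet_Ico,
    Set.inter_eq_left.2, Real.volume_Ico, smul_eq_mul, abs_of_nonpos (by linarith),
    ← ENNReal.ofReal_inv_of_pos (by norm_num), ← ENNReal.ofReal_mul (by norm_num)]
  · congr 1; ring
  · intro t ht
    exact ⟨by linarith [ht.1], by linarith [ht.2]⟩

lemma aux_abs_sin (c : ℝ) : ∫ b in (0:ℝ)..(2 * π), |Real.sin (b + c)| = 4 := by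
  have hper : Function.Periodic (fun x : ℝ => |Real.sin x|) π := by
    intro x
    simp [Real.sin_add_pi]
  have h0 : ∫ b in (0:ℝ)..π, |Real.sin b| = 2 := by
    have h00 : ∫ b in (0:ℝ)..π, Real.sin b = 2 := by
      rw [integral_sin]; norm_num
    rw [← h00]
    apply intervalIntegral.integral_congr
    intro x hx
    rw [Set.uIcc_of_le Real.pi_pos.le] at hx
    exact abs_of_nonneg (Real.sin_nonneg_of_nonneg_of_le_pi hx.1 hx.2)
  have h := hper.intervalIntegral_add_zsmul_eq 2 c
    (fun a b => (Continuous.intervalIntegrable (by fun_prop) a b))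
  rw [hper.intervalIntegral_add_eq c 0, zero_add, h0] at h
  rw [intervalIntegral.integral_comp_add_right (fun x => |Real.sin x|)]
  rw [zero_add, add_comm]
  simp at h
  rw [h]; norm_num

lemma aux_bt (α β : ℝ) :
    ((unifIcc 0 (2 * π)).prod (unifIcc (-1) 1))
      {r : ℝ × ℝ | sgn01 (Real.cos (α + r.1) + r.2) ≠ sgn01 (Real.cos (β + r.1) + r.2)} =
      ENNReal.ofReal (2 / π * |Real.sin ((α - β) / 2)|) := by
  haveI := aux_unif_prob (-1) 1 (by norm_num)
  have hms : Measurable sgn01 := Measurable.ite measurableSet_Ici measurable_const measurable_const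
  rw [Measure.prod_apply]
  · have : ∀ b : ℝ, unifIcc (-1) 1 (Prod.mk b ⁻¹'
      {r : ℝ × ℝ | sgn01 (Real.cos (α + r.1) + r.2) ≠ sgn01 (Real.cos (β + r.1) + r.2)}) =
      ENNReal.ofReal (|Real.sin ((α - β) / 2)| * |Real.sin (b + (α + β) / 2)|) := by
      intro b
      have := aux_t (Real.cos (α + b)) (Real.cos (β + b)) (Real.abs_cos_le_one _)
        (Real.abs_cos_le_one _)
      rw [Set.preimage_setOf_eq, this, Real.cos_sub_cos, abs_mul, abs_mul]
      congr 1
      rw [show (α + b + (β + b)) / 2 = b + (α + β) / 2 by ring,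
        show (α + b - (β + b)) / 2 = (α - β) / 2 by ring]
      norm_num
      ring
    simp only [this]
    rw [unifIcc, lintegral_smul_measure, ← ofReal_integral_eq_lintegral_ofReal, integral_const_mul,
      integral_Icc_eq_integral_Ioc, ← intervalIntegral.integral_of_le (by positivity), aux_abs_sin,
      smul_eq_mul, ← ENNReal.ofReal_inv_of_pos (by simp [Real.pi_pos]), ← ENNReal.ofReal_mul]
    · congr 1
      have := Real.pi_ne_zero
      field_simp
      ring
    · simp [Real.pi_pos.le]
    · exact Continuous.integrableOn_Icc (by fun_prop)
    · exact ae_of_all _ fun b => by positivity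
  · exact (measurableSet_eq_fun (by fun_prop) (by fun_prop)).compl

/-- P = (2/π) E|sin(D/2)|. -/
lemma aux_prob {dw dv : ℕ} (X Y : Matrix (Fin dw) (Fin dv) ℝ) :
    (hashLaw dw dv {p | hashBit X p ≠ hashBit Y p}).toReal =
     2 / π * ∫ p, |Real.sin ((p.1 ⬝ᵥ ((X - Y) *ᵥ p.2)) / 2)|
      ∂((_root_.stdGaussian dw).prod (_root_.stdGaussian dv)) := by
  haveI := aux_unif_prob (-1) 1 (by norm_num)
  haveI := aux_unif_prob 0 (2 * π) (by positivity)
  have hms : Measurable sgn01 := Measurable.ite measurableSet_Ici measurable_const measurable_const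
  have hmf : ∀ A : Matrix (Fin dw) (Fin dv) ℝ,
      Measurable (fun p : (Fin dw → ℝ) × (Fin dv → ℝ) => p.1 ⬝ᵥ (A *ᵥ p.2)) := by
    intro A
    unfold dotProduct Matrix.mulVec dotProduct
    fun_prop
  have hmh : ∀ A : Matrix (Fin dw) (Fin dv) ℝ, Measurable (hashBit A) := by
    intro A
    unfold hashBit
    have : Measurable (fun p : (Fin dw → ℝ) × (Fin dv → ℝ) × ℝ × ℝ => p.1 ⬝ᵥ (A *ᵥ p.2.1)) :=
      (hmf A).comp (by fun_prop : Measurable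
        (fun p : (Fin dw → ℝ) × (Fin dv → ℝ) × ℝ × ℝ => (p.1, p.2.1)))
    fun_prop
  have hset : MeasurableSet {p | hashBit X p ≠ hashBit Y p} :=
    (measurableSet_eq_fun (hmh X) (hmh Y)).compl
  have h1 : hashLaw dw dv {p | hashBit X p ≠ hashBit Y p} =
      ∫⁻ p, ENNReal.ofReal (2 / π * |Real.sin ((p.1 ⬝ᵥ ((X - Y) *ᵥ p.2)) / 2)|)
        ∂((_root_.stdGaussian dw).prod (_root_.stdGaussian dv)) := by
    have hmm := hmf (X - Y)
    rw [hashLaw, Measure.prod_apply hset, lintegral_prod _ (by fun_prop)]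
    apply lintegral_congr
    intro w
    rw [Measure.prod_apply (measurable_prodMk_left hset)]
    apply lintegral_congr
    intro v
    have := aux_bt (w ⬝ᵥ (X *ᵥ v)) (w ⬝ᵥ (Y *ᵥ v))
    rw [← dotProduct_sub, ← Matrix.sub_mulVec] at this
    rw [← this]
    rfl
  have hmm := hmf (X - Y)
  rw [h1, ← integral_const_mul, ← integral_eq_lintegral_of_nonneg_ae]
  · exact ae_of_all _ fun p => by positivity
  · exact Measurable.aestronglyMeasurable (by fun_prop)

/-- Upper bound on the expected Hamming distance:
P(h(X) ≠ h(Y)) ≤ min{ (1/2)√(1 − κ_g(X−Y)), (4/π²)(1 − (2/3)κ_g(X−Y)) }. -/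
theorem expected_hamming_distance_upper {dw dv : ℕ} (hdw : 0 < dw) (hdv : 0 < dv)
    (X Y : Matrix (Fin dw) (Fin dv) ℝ) :
    (hashLaw dw dv {p | hashBit X p ≠ hashBit Y p}).toReal ≤
      min (1 / 2 * Real.sqrt (1 - kg (X - Y)))
        (4 / π ^ 2 * (1 - 2 / 3 * kg (X - Y))) := by
  have hm : Measurable (fun p : (Fin dw → ℝ) × (Fin dv → ℝ) => p.1 ⬝ᵥ ((X - Y) *ᵥ p.2)) := by
    unfold dotProduct Matrix.mulVec dotProduct
    fun_prop
  have hk := aux_kg (X - Y)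
  have hpi := Real.pi_pos
  rw [aux_prob]
  apply le_min
  · have h := aux_mean2 ((_root_.stdGaussian dw).prod (_root_.stdGaussian dv)) _ hm
    refine (mul_le_mul_of_nonneg_left h (by positivity)).trans ?_
    set c := ∫ p, Real.cos (p.1 ⬝ᵥ ((X - Y) *ᵥ p.2))
      ∂((_root_.stdGaussian dw).prod (_root_.stdGaussian dv))
    have hk1 : kg (X - Y) ≤ 1 := by
      unfold kg
      rw [Real.exp_le_one_iff]
      have : 0 ≤ ∑ i, ∑ j, ((X - Y) i j) ^ 2 :=
        Finset.sum_nonneg (fun i _ => Finset.sum_nonneg (fun j _ => sq_nonneg _))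
      linarith
    have h1 : Real.sqrt ((1 - c) / 2) ≤ Real.sqrt (1 - kg (X - Y)) / Real.sqrt 2 := by
      rw [← Real.sqrt_div (by linarith)]
      apply Real.sqrt_le_sqrt
      linarith
    refine (mul_le_mul_of_nonneg_left h1 (by positivity)).trans ?_
    have h2 : 2 / π / Real.sqrt 2 ≤ 1 / 2 := by
      rw [div_div, div_le_div_iff₀ (by positivity) (by norm_num)]
      have := Real.pi_gt_three
      have h4 : (1.4:ℝ) ≤ Real.sqrt 2 := Real.le_sqrt_of_sq_le (by norm_num)
      nlinarith
    calc 2 / π * (Real.sqrt (1 - kg (X - Y)) / Real.sqrt 2)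
        = 2 / π / Real.sqrt 2 * Real.sqrt (1 - kg (X - Y)) := by ring
      _ ≤ _ := mul_le_mul_of_nonneg_right h2 (Real.sqrt_nonneg _)
  · have h := aux_mean ((_root_.stdGaussian dw).prod (_root_.stdGaussian dv)) _ hm ?_
    · refine (mul_le_mul_of_nonneg_left h (by positivity)).trans ?_
      rw [← mul_assoc, show 2 / π * (2 / π) = 4 / π ^ 2 by field_simp; norm_num]
      apply mul_le_mul_of_nonneg_left _ (by positivity)
      linarith
    · intro n
      have h := aux_kg ((n:ℝ) • (X - Y))
      have h0 : 0 ≤ kg ((n:ℝ) • (X - Y)) := (Real.exp_pos _).le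
      refine (h0.trans h).trans_eq ?_
      congr 1
      ext p
      rw [Matrix.smul_mulVec, dotProduct_smul, smul_eq_mul]
end

section
/- Let d_w, d_v be positive integers and let X, Y be real d_w × d_v matrices. Then P(h₁(X) ≠ h₁(Y) and h₂(X) ≠ h₂(Y)) = (64/π⁴)·Σ_{m=1}^∞ Σ_{n=1}^∞ [1 − κ_b(m·(X−Y)) − κ_b(n·(X−Y)) + κ_b(√(m² + n²)·(X−Y))] / ((4m² − 1)(4n² − 1)), where the probability is over (w, v₁, v₂, b₁, b₂, t₁, t₂). -/
open MeasureTheory ProbabilityTheory Matrix Real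

/-- Joint law of (w, v₁, v₂, b₁, b₂, t₁, t₂):
w ~ N(0, I_{d_w}), v₁, v₂ ~ N(0, I_{d_v}), b₁, b₂ ~ Unif[0, 2π],
t₁, t₂ ~ Unif[−1, 1], all mutually independent. -/
noncomputable def hashLaw2 (dw dv : ℕ) :
    Measure ((Fin dw → ℝ) × (Fin dv → ℝ) × (Fin dv → ℝ) × ℝ × ℝ × ℝ × ℝ) :=
  (stdGaussian dw).prod ((stdGaussian dv).prod ((stdGaussian dv).prod
    ((unifIcc 0 (2 * π)).prod ((unifIcc 0 (2 * π)).prod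
      ((unifIcc (-1) 1).prod (unifIcc (-1) 1))))))

/-- First hash bit h₁(X) = sgn(cos(wᵀ X v₁ + b₁) + t₁): shares w with h₂. -/
noncomputable def hashBit1 {dw dv : ℕ} (X : Matrix (Fin dw) (Fin dv) ℝ)
    (p : (Fin dw → ℝ) × (Fin dv → ℝ) × (Fin dv → ℝ) × ℝ × ℝ × ℝ × ℝ) : ℝ :=
  sgn01 (Real.cos (p.1 ⬝ᵥ (X *ᵥ p.2.1) + p.2.2.2.1) + p.2.2.2.2.2.1)

/-- Second hash bit h₂(X) = sgn(cos(wᵀ X v₂ + b₂) + t₂): shares w with h₁. -/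
noncomputable def hashBit2 {dw dv : ℕ} (X : Matrix (Fin dw) (Fin dv) ℝ)
    (p : (Fin dw → ℝ) × (Fin dv → ℝ) × (Fin dv → ℝ) × ℝ × ℝ × ℝ × ℝ) : ℝ :=
  sgn01 (Real.cos (p.1 ⬝ᵥ (X *ᵥ p.2.2.1) + p.2.2.2.2.1) + p.2.2.2.2.2.2)



lemma abs_sin_per : Function.Periodic (fun u : ℝ => ((|Real.sin (u / 2)| : ℝ) : ℂ)) (2 * π) := by
  intro u
  have : (u + 2 * π) / 2 = u / 2 + π := by ring
  simp only [this, Real.sin_add_pi, abs_neg]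

noncomputable def fSin : C(AddCircle (2 * π), ℂ) where
  toFun := abs_sin_per.lift
  continuous_toFun := by
    apply continuous_coinduced_dom.mpr
    show Continuous (fun u : ℝ => ((|Real.sin (u / 2)| : ℝ) : ℂ))
    fun_prop

lemma fSin_coe (u : ℝ) : fSin (u : AddCircle (2 * π)) = ((|Real.sin (u / 2)| : ℝ) : ℂ) := 
  abs_sin_per.lift_coe u

lemma int_exp_half (n : ℤ) :
    ∫ x in (0:ℝ)..(2 * π), Complex.exp (-Complex.I * n * x) * ((Real.sin (x / 2) : ℝ) : ℂ) = 
      - 4 / (4 * (n:ℂ) ^ 2 - 1) := by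
  have hI := Complex.I_ne_zero
  have h1' : (1 - 2 * (n:ℂ)) ≠ 0 := by
    norm_cast
    omega
  have h2' : (1 + 2 * (n:ℂ)) ≠ 0 := by
    norm_cast
    omega
  have h1 : Complex.I * (1 / 2 - n) ≠ 0 := by
    refine mul_ne_zero hI fun h => h1' ?_
    linear_combination 2 * h
  have h2 : -(Complex.I * (1 / 2 + n)) ≠ 0 := by
    refine neg_ne_zero.2 <| mul_ne_zero hI fun h => h2' ?_
    linear_combination 2 * h
  have e : ∀ x : ℝ, Complex.exp (-Complex.I * n * x) * ((Real.sin (x / 2) : ℝ) : ℂ) = 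
     (Complex.I / 2) * (Complex.exp (-(Complex.I * (1 / 2 + n)) * x) - 
      Complex.exp (Complex.I * (1 / 2 - n) * x)) := by
    intro x
    have a1 : -(Complex.I * (1 / 2 + n)) * x = -Complex.I * n * x + -(x/2 * Complex.I) := by ring
    have a2 : (Complex.I * (1 / 2 - n)) * x = -Complex.I * n * x + (x/2 * Complex.I) := by ring
    rw [a1, a2, Complex.exp_add, Complex.exp_add]
    push_cast
    rw [Complex.sin]
    simp only [neg_mul]
    ring
  simp_rw [e]
  rw [intervalIntegral.integral_const_mul, intervalIntegral.integral_sub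
    (Continuous.intervalIntegrable (by fun_prop) _ _) (Continuous.intervalIntegrable (by fun_prop) _ _),
    integral_exp_mul_complex h1, integral_exp_mul_complex h2]
  have b1 : Complex.exp (-(Complex.I * (1 / 2 + n)) * ((2 * π : ℝ) : ℂ)) = -1 := by
    have : -(Complex.I * (1 / 2 + n)) * ((2 * π : ℝ) : ℂ) = 
      -(π * Complex.I) + (-n : ℤ) * (2 * π * Complex.I) := by push_cast; ring
    rw [this, Complex.exp_add, Complex.exp_int_mul_two_pi_mul_I, Complex.exp_neg, Complex.exp_pi_mul_I]
    norm_num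
  have b2 : Complex.exp ((Complex.I * (1 / 2 - n)) * ((2 * π : ℝ) : ℂ)) = -1 := by
    have : (Complex.I * (1 / 2 - n)) * ((2 * π : ℝ) : ℂ) = 
      (π * Complex.I) + (-n : ℤ) * (2 * π * Complex.I) := by push_cast; ring
    rw [this, Complex.exp_add, Complex.exp_int_mul_two_pi_mul_I, Complex.exp_pi_mul_I]
    norm_num
  rw [b1, b2]
  have h3 : (4 * (n:ℂ) ^ 2 - 1) ≠ 0 := by
    have : (4 * (n:ℂ) ^ 2 - 1) = -((1 - 2 * n) * (1 + 2 * n)) := by ring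
    rw [this]; exact neg_ne_zero.2 (mul_ne_zero h1' h2')
  have h4 : (1 / 2 - n : ℂ) = (1 - 2 * n) / 2 := by ring
  have h5 : (1 / 2 + n : ℂ) = (1 + 2 * n) / 2 := by ring
  have h6 : (4 * (n:ℂ) ^ 2 - 1) = -((1 - 2 * n) * (1 + 2 * n)) := by ring
  rw [h4, h5, h6]
  simp only [Complex.ofReal_zero, mul_zero, Complex.exp_zero]
  field_simp
  ring

instance factTwoPi' : Fact (0 < 2 * π) := ⟨by positivity⟩

lemma coeff_fSin (n : ℤ) : fourierCoeff fSin n = ((-(2 / π) / (4 * (n:ℝ) ^ 2 - 1) : ℝ) : ℂ) := by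
  rw [fourierCoeff_eq_intervalIntegral _ _ 0, zero_add]
  have : ∫ x in (0:ℝ)..(2 * π), fourier (-n) (x : AddCircle (2 * π)) • fSin (x : AddCircle (2 * π)) = 
     ∫ x in (0:ℝ)..(2 * π), Complex.exp (-Complex.I * n * x) * ((Real.sin (x / 2) : ℝ) : ℂ) := by
    apply intervalIntegral.integral_congr
    intro x hx
    rw [Set.uIcc_of_le (by positivity)] at hx
    simp only
    rw [fSin_coe, fourier_coe_apply, abs_of_nonneg, smul_eq_mul]
    · congr 2
      push_cast
      have := Real.pi_ne_zero
      field_simp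
    · apply Real.sin_nonneg_of_nonneg_of_le_pi <;> linarith [hx.1, hx.2]
  rw [this, int_exp_half]
  rw [Complex.real_smul]
  push_cast
  have : (π : ℂ) ≠ 0 := by exact_mod_cast Real.pi_ne_zero
  field_simp
  ring

lemma summable_coeff : Summable (fun n : ℤ => (-(2 / π) / (4 * (n:ℝ) ^ 2 - 1) : ℝ)) := by
  have h : Summable (fun n : ℤ => 1 / (n:ℝ) ^ 2) := Real.summable_one_div_int_pow.2 one_lt_two
  refine Summable.of_norm_bounded_eventually (g := fun n : ℤ => (2 / π) * (1 / (n:ℝ) ^ 2)) (h.mul_left _) ?_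
  rw [Filter.eventually_cofinite]
  refine (Set.finite_singleton (0:ℤ)).subset ?_
  intro n hn
  by_contra h0
  apply hn
  have h1 : (1:ℝ) ≤ (n:ℝ) ^ 2 := by
    have : n ≠ 0 := h0
    have : 1 ≤ n ^ 2 := by have := sq_pos_of_ne_zero this; omega
    exact_mod_cast this
  have h2 : 0 < 4 * (n:ℝ)^2 - 1 := by linarith
  rw [norm_div, norm_neg, Real.norm_of_nonneg (by positivity), Real.norm_of_nonneg h2.le, div_eq_mul_one_div]
  gcongr
  linarith

lemma hasSum_abs_sin (u : ℝ) :
    HasSum (fun m : ℕ+ => (1 - Real.cos (m * u)) / (4 * (m:ℝ) ^ 2 - 1)) (π / 4 * |Real.sin (u / 2)|) := by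
  have hs : Summable (fourierCoeff fSin) := by
    rw [funext coeff_fSin]
    exact Complex.summable_ofReal.2 summable_coeff
  have hu : ∀ u : ℝ, HasSum (fun n : ℤ => -(2 / π) / (4 * (n:ℝ) ^ 2 - 1) * Real.cos (n * u)) (|Real.sin (u / 2)|) := by
    intro u
    have := has_pointwise_sum_fourier_series_of_summable hs (u : AddCircle (2 * π))
    rw [fSin_coe] at this
    have := Complex.hasSum_re this
    rw [Complex.ofReal_re] at this
    convert! this using 2 with n
    rw [coeff_fSin, smul_eq_mul, Complex.re_ofReal_mul, fourier_coe_apply]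
    congr 1
    have : (2 * π * Complex.I * n * u / ((2 * π : ℝ) : ℂ)) = ((n * u : ℝ) : ℂ) * Complex.I := by
      push_cast
      have : (π : ℂ) ≠ 0 := by exact_mod_cast Real.pi_ne_zero
      field_simp
    rw [this, Complex.exp_ofReal_mul_I_re]
  have h1 := ((hu u).sub (hu 0)).nat_add_neg
  have h2 : HasSum (fun n : ℕ => (4 / π) * ((1 - Real.cos (n * u)) / (4 * (n:ℝ) ^ 2 - 1))) |Real.sin (u / 2)| := by
    convert! h1 using 1
    · ext n; simp; ring
    · simp
  have h3 := h2.mul_left (π / 4)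
  have h4 : HasSum (fun n : ℕ => ((1 - Real.cos (n * u)) / (4 * (n:ℝ) ^ 2 - 1))) (π / 4 * |Real.sin (u / 2)|) := by
    convert! h3 using 2 with n
    have := Real.pi_ne_zero
    rw [← mul_assoc]
    field_simp
  rw [← PNat.coe_injective.hasSum_iff] at h4
  · exact h4
  · intro x hx
    have : x = 0 := by
      by_contra h
      exact hx ⟨⟨x, Nat.pos_of_ne_zero h⟩, rfl⟩
    simp [this]

lemma int_cos_std (d : ℕ) (a : Fin d → ℝ) :
    ∫ v, Real.cos (a ⬝ᵥ v) ∂(_root_.stdGaussian d) = Real.exp (-(a ⬝ᵥ a) / 2) := by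
  have h := charFun_stdGaussian (E := EuclideanSpace ℝ (Fin d)) (WithLp.toLp 2 a)
  rw [← map_pi_eq_stdGaussian, charFun_apply, integral_map (by fun_prop) (by fun_prop)] at h
  have h' := congrArg Complex.re h
  have hi : Integrable (fun x : Fin d → ℝ => Complex.exp (((inner ℝ (WithLp.toLp 2 x) (WithLp.toLp 2 a) : ℝ) : ℂ) * Complex.I))
     (Measure.pi fun _ => gaussianReal 0 1) := by
    refine Integrable.of_bound (C := 1) ?_ ?_
    · apply Continuous.aestronglyMeasurable; fun_prop
    · refine Filter.Eventually.of_forall fun x => ?_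
      rw [Complex.norm_exp_ofReal_mul_I]
  have h2 := integral_re (𝕜 := ℂ) hi
  simp only [RCLike.re_eq_complex_re] at h2
  rw [← h2] at h'
  unfold _root_.stdGaussian
  convert! h' using 1
  · congr 1; ext v
    rw [Complex.exp_ofReal_mul_I_re, EuclideanSpace.inner_toLp_toLp]
    simp
  · rw [← Complex.ofReal_pow, EuclideanSpace.real_norm_sq_eq]
    rw [show (-((∑ i, (WithLp.toLp 2 a) i ^ 2 : ℝ) : ℂ) / 2) = ((-(∑ i, a i ^ 2) / 2 : ℝ) : ℂ) by push_cast; rfl, ← Complex.ofReal_exp, Complex.ofReal_re]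
    simp [dotProduct, sq]

lemma int_gauss_one (l : ℝ) (hl : 0 < l) :
    ∫ x, Real.exp (-((l - 1) * x ^ 2) / 2) ∂(gaussianReal 0 1) = l ^ (-(1 / 2 : ℝ)) := by
  rw [integral_gaussianReal_eq_integral_smul (by simp)]
  have : ∀ x : ℝ, gaussianPDFReal 0 1 x • Real.exp (-((l - 1) * x ^ 2) / 2) = 
     (√(2 * π))⁻¹ * Real.exp (-(l / 2) * x ^ 2) := by
    intro x
    simp only [gaussianPDFReal, smul_eq_mul]
    rw [mul_assoc, ← Real.exp_add]
    simp only [NNReal.coe_one, mul_one, sub_zero]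
    congr 2
    ring
  simp_rw [this]
  rw [integral_const_mul, integral_gaussian, ← Real.sqrt_inv, ← Real.sqrt_mul (by positivity), Real.rpow_neg hl.le, ← Real.sqrt_eq_rpow, ← Real.sqrt_inv]
  congr 1
  field_simp

lemma quad_eig {d : ℕ} {N : Matrix (Fin d) (Fin d) ℝ} (hN : N.IsHermitian) (x : Fin d → ℝ) :
    let e := (∑ i, x i • hN.eigenvectorBasis i).ofLp
    e ⬝ᵥ e = ∑ i, x i ^ 2 ∧ e ⬝ᵥ (N *ᵥ e) = ∑ i, hN.eigenvalues i * x i ^ 2 := by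
  intro e
  have key : ∀ y : Fin d → ℝ, e ⬝ᵥ (∑ i, y i • hN.eigenvectorBasis i).ofLp = ∑ i, x i * y i := by
    intro y
    have := hN.eigenvectorBasis.orthonormal.inner_sum x y Finset.univ
    rw [EuclideanSpace.inner_eq_star_dotProduct] at this
    simp only [star_trivial] at this
    rw [dotProduct_comm]
    exact this
  refine ⟨by rw [key]; simp [sq], ?_⟩
  have : N *ᵥ e = (∑ i, (hN.eigenvalues i * x i) • hN.eigenvectorBasis i).ofLp := by
    simp only [e, WithLp.ofLp_sum, WithLp.ofLp_smul, Matrix.mulVec_sum, Matrix.mulVec_smul, hN.mulVec_eigenvectorBasis, smul_smul]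
    simp_rw [mul_comm]
  rw [this, key]
  apply Finset.sum_congr rfl; intros; ring

lemma det_pos_aux {dw dv : ℕ} (A : Matrix (Fin dw) (Fin dv) ℝ) : (1 + A * Aᵀ).PosDef := by
  have := Matrix.posSemidef_self_mul_conjTranspose A
  rw [conjTranspose_eq_transpose_of_trivial] at this
  exact Matrix.PosDef.one.add_posSemidef this

lemma int_exp_std {dw dv : ℕ} (A : Matrix (Fin dw) (Fin dv) ℝ) :
    ∫ w, Real.exp (-((w ᵥ* A) ⬝ᵥ (w ᵥ* A)) / 2) ∂(_root_.stdGaussian dw) = kb A := by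
  have hP := det_pos_aux A
  set N := 1 + A * Aᵀ with hNdef
  have hN := hP.isHermitian
  have q : ∀ w : Fin dw → ℝ, (w ᵥ* A) ⬝ᵥ (w ᵥ* A) = w ⬝ᵥ (N *ᵥ w) - w ⬝ᵥ w := by
    intro w
    rw [hNdef, Matrix.add_mulVec, Matrix.one_mulVec, dotProduct_add, add_sub_cancel_left, ← Matrix.mulVec_mulVec, Matrix.dotProduct_mulVec, Matrix.mulVec_transpose]
  simp_rw [q]
  have m : ∀ F : EuclideanSpace ℝ (Fin dw) → ℝ, Continuous F → 
     ∫ w, F (WithLp.toLp 2 w) ∂(_root_.stdGaussian dw) = ∫ x, F (∑ i, x i • hN.eigenvectorBasis i) ∂(_root_.stdGaussian dw) := by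
    intro F hF
    unfold _root_.stdGaussian
    rw [← integral_map (φ := WithLp.toLp 2) (f := F) (by fun_prop) hF.aestronglyMeasurable,
      ← integral_map (φ := fun x : Fin dw → ℝ => ∑ i, x i • hN.eigenvectorBasis i) (f := F) (Continuous.aemeasurable (by fun_prop)) hF.aestronglyMeasurable,
      ← stdGaussian_eq_map_pi_orthonormalBasis, map_pi_eq_stdGaussian]
  have := m (fun e => Real.exp (-(e.ofLp ⬝ᵥ (N *ᵥ e.ofLp) - e.ofLp ⬝ᵥ e.ofLp) / 2)) (by
    simp only [dotProduct, Matrix.mulVec]; fun_prop)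
  simp only at this
  rw [this]
  have h2 : ∀ x : Fin dw → ℝ, Real.exp (-((∑ i, x i • hN.eigenvectorBasis i).ofLp ⬝ᵥ (N *ᵥ (∑ i, x i • hN.eigenvectorBasis i).ofLp) - (∑ i, x i • hN.eigenvectorBasis i).ofLp ⬝ᵥ (∑ i, x i • hN.eigenvectorBasis i).ofLp) / 2) = ∏ i, Real.exp (-((hN.eigenvalues i - 1) * x i ^ 2) / 2) := by
    intro x
    rw [(quad_eig hN x).1, (quad_eig hN x).2, ← Real.exp_sum, ← Finset.sum_sub_distrib, ← Finset.sum_neg_distrib, Finset.sum_div]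
    congr 1
    apply Finset.sum_congr rfl; intros; ring
  simp_rw [h2]
  unfold _root_.stdGaussian
  rw [integral_fintype_prod_eq_prod (f := fun i (y:ℝ) => Real.exp (-((hN.eigenvalues i - 1) * y ^ 2) / 2))]
  simp_rw [fun i => int_gauss_one _ (hP.eigenvalues_pos i)]
  rw [kb, ← hNdef, hN.det_eq_prod_eigenvalues, Real.finsetProd_rpow _ _ (fun i _ => (hP.eigenvalues_pos i).le)]
  rfl

lemma unifIcc_prob {a b : ℝ} (h : a < b) : IsProbabilityMeasure (unifIcc a b) := by
  constructor
  rw [unifIcc, Measure.smul_apply, Measure.restrict_apply_univ, Real.volume_Icc, smul_eq_mul,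
    ENNReal.inv_mul_cancel]
  · simpa using h
  · exact ENNReal.ofReal_ne_top

lemma measurable_sgn01 : Measurable sgn01 := by
  unfold sgn01
  exact Measurable.ite measurableSet_Ici measurable_const measurable_const

noncomputable def bitNe (x y b t : ℝ) : ENNReal :=
  open Classical in if sgn01 (Real.cos (x + b) + t) ≠ sgn01 (Real.cos (y + b) + t) then 1 else 0

lemma measurable_bitNe {α : Type*} [MeasurableSpace α] {x y b t : α → ℝ} (hx : Measurable x) 
    (hy : Measurable y) (hb : Measurable b) (ht : Measurable t) :
    Measurable (fun a => bitNe (x a) (y a) (b a) (t a)) := by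
  unfold bitNe
  refine Measurable.ite ?_ measurable_const measurable_const
  exact (measurableSet_eq_fun (measurable_sgn01.comp (by fun_prop)) (measurable_sgn01.comp (by fun_prop))).compl

lemma sgn_ne_set (c c' : ℝ) : {t : ℝ | sgn01 (c + t) ≠ sgn01 (c' + t)} = Set.Ico (-(max c c')) (-(min c c')) := by
  ext t
  simp only [Set.mem_ofPred_eq, Set.mem_Ico, sgn01]
  rcases le_total c c' with h | h
  · rw [max_eq_right h, min_eq_left h]
    split_ifs <;> simp <;> (try constructor) <;> intros <;> linarith
  · rw [max_eq_left h, min_eq_right h]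
    split_ifs <;> simp <;> (try constructor) <;> intros <;> linarith

lemma int_t (x y b : ℝ) : ∫⁻ t, bitNe x y b t ∂(unifIcc (-1) 1) = 
    ENNReal.ofReal (|Real.cos (x + b) - Real.cos (y + b)| / 2) := by
  have e : (fun t => bitNe x y b t) = Set.indicator 
      (Set.Ico (-(max (Real.cos (x + b)) (Real.cos (y + b)))) (-(min (Real.cos (x + b)) (Real.cos (y + b))))) 1 := by
    rw [← sgn_ne_set]
    ext t
    simp [bitNe, Set.indicator_apply]
  rw [e, lintegral_indicator_one measurableSet_Ico, unifIcc, Measure.smul_apply, Measure.restrict_apply measurableSet_Ico,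
    Set.inter_eq_left.2, Real.volume_Ico]
  · rw [smul_eq_mul, ← ENNReal.ofReal_inv_of_pos (by norm_num), ← ENNReal.ofReal_mul (by norm_num)]
    congr 1
    rw [← max_sub_min_eq_abs']
    ring
  · intro t ht
    have h1 : max (Real.cos (x + b)) (Real.cos (y + b)) ≤ 1 := max_le (Real.cos_le_one _) (Real.cos_le_one _)
    have h2 : -1 ≤ min (Real.cos (x + b)) (Real.cos (y + b)) := le_min (Real.neg_one_le_cos _) (Real.neg_one_le_cos _)
    constructor <;> linarith [ht.1, ht.2]

lemma int_abs_sin_shift (a : ℝ) : ∫ b in (0:ℝ)..(2 * π), |Real.sin (b + a)| = 4 := by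
  have hper : Function.Periodic (fun b : ℝ => |Real.sin b|) π := by
    intro u; simp [Real.sin_add_pi]
  have hper2 : Function.Periodic (fun b : ℝ => |Real.sin b|) (2 * π) := by
    intro u; simp
  rw [intervalIntegral.integral_comp_add_right (fun b => |Real.sin b|), zero_add, add_comm (2 * π) a,
    hper2.intervalIntegral_add_eq a 0, zero_add]
  have h0 : ∫ b in (0:ℝ)..π, |Real.sin b| = 2 := by
    rw [show (2:ℝ) = ∫ b in (0:ℝ)..π, Real.sin b by rw [integral_sin]; norm_num]
    apply intervalIntegral.integral_congr
    intro t ht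
    rw [Set.uIcc_of_le Real.pi_pos.le] at ht
    exact abs_of_nonneg (Real.sin_nonneg_of_mem_Icc ht)
  have h1 := hper.intervalIntegral_add_eq π 0
  rw [zero_add, h0] at h1
  rw [← intervalIntegral.integral_add_adjacent_intervals (b := π) (Continuous.intervalIntegrable (by fun_prop) _ _)
    (Continuous.intervalIntegrable (by fun_prop) _ _), h0, two_mul π, h1]
  norm_num

noncomputable def SS (u : ℝ) : ENNReal := ENNReal.ofReal (2 / π * |Real.sin (u / 2)|)

lemma measurable_SS : Measurable SS := by unfold SS; fun_prop

lemma int_b (x y : ℝ) : ∫⁻ b, ENNReal.ofReal (|Real.cos (x + b) - Real.cos (y + b)| / 2) ∂(unifIcc 0 (2 * π)) = 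
    SS (x - y) := by
  have hpi := Real.pi_pos
  rw [unifIcc, lintegral_smul_measure, ← ofReal_integral_eq_lintegral_ofReal, integral_Icc_eq_integral_Ioc,
    ← intervalIntegral.integral_of_le (by positivity), smul_eq_mul, sub_zero, 
    ← ENNReal.ofReal_inv_of_pos (by positivity), ← ENNReal.ofReal_mul (by positivity), SS]
  · congr 1
    have : ∀ b : ℝ, |Real.cos (x + b) - Real.cos (y + b)| / 2 = |Real.sin ((x - y) / 2)| * |Real.sin (b + (x + y) / 2)| := by
      intro b
      rw [Real.cos_sub_cos, abs_mul, abs_mul]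
      rw [show (x + b + (y + b)) / 2 = b + (x + y) / 2 by ring, show (x + b - (y + b)) / 2 = (x - y) / 2 by ring]
      norm_num
      ring
    simp_rw [this]
    rw [intervalIntegral.integral_const_mul, int_abs_sin_shift]
    field_simp
    ring
  · apply Continuous.integrableOn_Icc; fun_prop
  · exact Filter.Eventually.of_forall fun _ => by positivity

lemma hash_lintegral {dw dv : ℕ} (X Y : Matrix (Fin dw) (Fin dv) ℝ) :
    hashLaw2 dw dv {p | hashBit1 X p ≠ hashBit1 Y p ∧ hashBit2 X p ≠ hashBit2 Y p} =
      ∫⁻ w, (∫⁻ v, SS ((w ᵥ* (X - Y)) ⬝ᵥ v) ∂(_root_.stdGaussian dv)) * 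
        (∫⁻ v, SS ((w ᵥ* (X - Y)) ⬝ᵥ v) ∂(_root_.stdGaussian dv)) ∂(_root_.stdGaussian dw) := by
  have : IsProbabilityMeasure (unifIcc (-1) 1) := unifIcc_prob (by norm_num)
  have : IsProbabilityMeasure (unifIcc 0 (2 * π)) := unifIcc_prob (by positivity)
  have mdot : ∀ Z : Matrix (Fin dw) (Fin dv) ℝ, Measurable (fun q : (Fin dw → ℝ) × (Fin dv → ℝ) => q.1 ⬝ᵥ (Z *ᵥ q.2)) := by
    intro Z
    simp only [dotProduct, Matrix.mulVec]
    fun_prop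
  have mB : Measurable (fun q : (Fin dw → ℝ) × (Fin dv → ℝ) × ℝ × ℝ => 
      bitNe (q.1 ⬝ᵥ (X *ᵥ q.2.1)) (q.1 ⬝ᵥ (Y *ᵥ q.2.1)) q.2.2.1 q.2.2.2) :=
    measurable_bitNe ((mdot X).comp (by fun_prop : Measurable (fun q : (Fin dw → ℝ) × (Fin dv → ℝ) × ℝ × ℝ => (q.1, q.2.1))))
      ((mdot Y).comp (by fun_prop : Measurable (fun q : (Fin dw → ℝ) × (Fin dv → ℝ) × ℝ × ℝ => (q.1, q.2.1)))) (by fun_prop) (by fun_prop)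
  obtain ⟨B, hB⟩ : ∃ B : (Fin dw → ℝ) × (Fin dv → ℝ) × ℝ × ℝ → ENNReal, B = (fun q => 
      bitNe (q.1 ⬝ᵥ (X *ᵥ q.2.1)) (q.1 ⬝ᵥ (Y *ᵥ q.2.1)) q.2.2.1 q.2.2.2) := ⟨_, rfl⟩
  rw [← hB] at mB
  have h1 : hashLaw2 dw dv {p | hashBit1 X p ≠ hashBit1 Y p ∧ hashBit2 X p ≠ hashBit2 Y p} = 
      ∫⁻ p, B (p.1, p.2.1, p.2.2.2.1, p.2.2.2.2.2.1) * B (p.1, p.2.2.1, p.2.2.2.2.1, p.2.2.2.2.2.2) ∂(hashLaw2 dw dv) := by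
    have hm : Measurable (fun p : (Fin dw → ℝ) × (Fin dv → ℝ) × (Fin dv → ℝ) × ℝ × ℝ × ℝ × ℝ => B (p.1, p.2.1, p.2.2.2.1, p.2.2.2.2.2.1) * B (p.1, p.2.2.1, p.2.2.2.2.1, p.2.2.2.2.2.2)) := by fun_prop
    have e : (fun p : (Fin dw → ℝ) × (Fin dv → ℝ) × (Fin dv → ℝ) × ℝ × ℝ × ℝ × ℝ => B (p.1, p.2.1, p.2.2.2.1, p.2.2.2.2.2.1) * B (p.1, p.2.2.1, p.2.2.2.2.1, p.2.2.2.2.2.2)) = 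
      Set.indicator {p | hashBit1 X p ≠ hashBit1 Y p ∧ hashBit2 X p ≠ hashBit2 Y p} 1 := by
      ext p
      simp only [hB, bitNe, Set.indicator_apply, Set.mem_ofPred_eq, hashBit1, hashBit2, Pi.one_apply]
      split_ifs <;> simp_all
    have hs : MeasurableSet {p : (Fin dw → ℝ) × (Fin dv → ℝ) × (Fin dv → ℝ) × ℝ × ℝ × ℝ × ℝ | hashBit1 X p ≠ hashBit1 Y p ∧ hashBit2 X p ≠ hashBit2 Y p} := by
      rw [e] at hm
      exact (measurable_indicator_const_iff (1 : ENNReal)).1 hm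
    rw [e, lintegral_indicator_one hs]
  rw [h1, hashLaw2, lintegral_prod _ (by fun_prop)]
  refine lintegral_congr fun w => ?_
  rw [lintegral_prod _ (by fun_prop)]
  have mS : Measurable (fun v : Fin dv → ℝ => SS ((w ᵥ* (X - Y)) ⬝ᵥ v)) := by
    have h : Measurable (fun v : Fin dv → ℝ => (w ᵥ* (X - Y)) ⬝ᵥ v) := by
      simp only [dotProduct]
      fun_prop
    exact measurable_SS.comp h
  rw [← lintegral_mul_const _ mS]
  refine lintegral_congr fun v1 => ?_
  rw [lintegral_prod _ (by fun_prop), ← lintegral_const_mul _ mS]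
  refine lintegral_congr fun v2 => ?_
  have Bt : ∀ v b, ∫⁻ t, B (w, v, b, t) ∂(unifIcc (-1) 1) = ENNReal.ofReal (|Real.cos (w ⬝ᵥ (X *ᵥ v) + b) - Real.cos (w ⬝ᵥ (Y *ᵥ v) + b)| / 2) := by
    intro v b
    rw [← int_t, hB]
  have Bb : ∀ v, ∫⁻ b, ∫⁻ t, B (w, v, b, t) ∂(unifIcc (-1) 1) ∂(unifIcc 0 (2 * π)) = SS ((w ᵥ* (X - Y)) ⬝ᵥ v) := by
    intro v
    simp_rw [Bt]
    rw [int_b, ← dotProduct_sub, ← Matrix.sub_mulVec, Matrix.dotProduct_mulVec]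
  rw [← Bb v1, ← Bb v2, lintegral_prod _ (by fun_prop)]
  have mBb : ∀ v, Measurable (fun b => ∫⁻ t, B (w, v, b, t) ∂(unifIcc (-1) 1)) := by
    intro v; simp_rw [Bt]; fun_prop
  rw [← lintegral_mul_const _ (mBb v1)]
  refine lintegral_congr fun b1 => ?_
  rw [lintegral_prod _ (by fun_prop), ← lintegral_const_mul _ (mBb v2)]
  refine lintegral_congr fun b2 => ?_
  rw [lintegral_prod _ (by fun_prop), ← lintegral_mul_const _ (by fun_prop)]
  refine lintegral_congr fun t1 => ?_
  rw [← lintegral_const_mul _ (by fun_prop)]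

noncomputable def cc (m : ℕ+) : ℝ := 8 / π ^ 2 / (4 * (m:ℝ) ^ 2 - 1)

lemma den_pos (m : ℕ+) : 0 < 4 * (m:ℝ) ^ 2 - 1 := by
  have : (1:ℝ) ≤ m := by exact_mod_cast one_le (a := m)
  nlinarith

lemma cc_nonneg (m : ℕ+) : 0 ≤ cc m := by
  have := den_pos m
  unfold cc; positivity

lemma SS_tsum (u : ℝ) : SS u = ∑' m : ℕ+, ENNReal.ofReal (cc m * (1 - Real.cos (m * u))) := by
  have h := (hasSum_abs_sin u).mul_left (8 / π ^ 2)
  have h' : HasSum (fun m : ℕ+ => cc m * (1 - Real.cos (m * u))) (2 / π * |Real.sin (u / 2)|) := by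
    have := Real.pi_ne_zero
    convert! h using 1
    · ext m; unfold cc; ring
    · field_simp; ring
  rw [← ENNReal.ofReal_tsum_of_nonneg _ h'.summable, h'.tsum_eq, SS]
  intro m
  exact mul_nonneg (cc_nonneg m) (by linarith [Real.cos_le_one (m * u)])

noncomputable def EE {dw dv : ℕ} (A : Matrix (Fin dw) (Fin dv) ℝ) (w : Fin dw → ℝ) : ℝ :=
  Real.exp (-((w ᵥ* A) ⬝ᵥ (w ᵥ* A)) / 2)

lemma EE_cont {dw dv : ℕ} (A : Matrix (Fin dw) (Fin dv) ℝ) : Continuous (EE A) := by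
  unfold EE
  simp only [dotProduct, Matrix.vecMul]
  fun_prop

lemma EE_pos {dw dv : ℕ} (A : Matrix (Fin dw) (Fin dv) ℝ) (w : Fin dw → ℝ) : 0 ≤ EE A w := (Real.exp_pos _).le

lemma EE_le {dw dv : ℕ} (A : Matrix (Fin dw) (Fin dv) ℝ) (w : Fin dw → ℝ) : EE A w ≤ 1 := by
  unfold EE
  rw [Real.exp_le_one_iff]
  have : 0 ≤ (w ᵥ* A) ⬝ᵥ (w ᵥ* A) := Finset.sum_nonneg fun i _ => mul_self_nonneg _
  linarith

lemma EE_int {dw dv : ℕ} (A : Matrix (Fin dw) (Fin dv) ℝ) : Integrable (EE A) (_root_.stdGaussian dw) := by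
  refine Integrable.of_bound (C := 1) (EE_cont A).aestronglyMeasurable (Filter.Eventually.of_forall fun w => ?_)
  rw [Real.norm_of_nonneg (EE_pos A w)]
  exact EE_le A w

lemma EE_mul {dw dv : ℕ} (Z : Matrix (Fin dw) (Fin dv) ℝ) (a b : ℝ) (w : Fin dw → ℝ) :
    EE (a • Z) w * EE (b • Z) w = EE (√(a ^ 2 + b ^ 2) • Z) w := by
  unfold EE
  rw [← Real.exp_add]
  simp only [Matrix.vecMul_smul, smul_dotProduct, dotProduct_smul, smul_eq_mul]
  rw [← mul_assoc (√_), Real.mul_self_sqrt (by positivity)]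
  congr 1
  ring

lemma int_v {dw dv : ℕ} (Z : Matrix (Fin dw) (Fin dv) ℝ) (w : Fin dw → ℝ) :
    ∫⁻ v, SS ((w ᵥ* Z) ⬝ᵥ v) ∂(_root_.stdGaussian dv) = 
      ∑' m : ℕ+, ENNReal.ofReal (cc m * (1 - EE ((m:ℝ) • Z) w)) := by
  simp_rw [SS_tsum]
  have hc : ∀ a : Fin dv → ℝ, Continuous (fun v => Real.cos (a ⬝ᵥ v)) := by
    intro a; simp only [dotProduct]; fun_prop
  have e : ∀ (m : ℕ+) v, (m:ℝ) * ((w ᵥ* Z) ⬝ᵥ v) = (w ᵥ* ((m:ℝ) • Z)) ⬝ᵥ v := by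
    intro m v; rw [Matrix.vecMul_smul, smul_dotProduct, smul_eq_mul]
  simp_rw [e]
  rw [lintegral_tsum]
  · congr 1; ext m
    have hi : Integrable (fun v => Real.cos ((w ᵥ* ((m:ℝ) • Z)) ⬝ᵥ v)) (_root_.stdGaussian dv) :=
      Integrable.of_bound (C := 1) (hc _).aestronglyMeasurable (Filter.Eventually.of_forall fun v => Real.abs_cos_le_one _)
    rw [← ofReal_integral_eq_lintegral_ofReal]
    · rw [integral_const_mul, integral_sub (integrable_const _) hi, int_cos_std]
      simp [EE]
    · exact ((integrable_const _).sub hi).const_mul _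
    · refine Filter.Eventually.of_forall fun v => mul_nonneg (cc_nonneg m) ?_
      linarith [Real.cos_le_one ((w ᵥ* ((m:ℝ) • Z)) ⬝ᵥ v)]
  · intro m
    have := hc (w ᵥ* ((m:ℝ) • Z))
    exact Measurable.aemeasurable (ENNReal.measurable_ofReal.comp (by fun_prop))

lemma int_w {dw dv : ℕ} (Z : Matrix (Fin dw) (Fin dv) ℝ) (m n : ℕ+) :
    0 ≤ 1 - kb ((m : ℝ) • Z) - kb ((n : ℝ) • Z) + kb (Real.sqrt ((m : ℝ) ^ 2 + (n : ℝ) ^ 2) • Z) ∧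
    ∫⁻ w, ENNReal.ofReal (cc m * (1 - EE ((m:ℝ) • Z) w)) * ENNReal.ofReal (cc n * (1 - EE ((n:ℝ) • Z) w)) ∂(_root_.stdGaussian dw) =
    ENNReal.ofReal (cc m * cc n * (1 - kb ((m : ℝ) • Z) - kb ((n : ℝ) • Z) +
              kb (Real.sqrt ((m : ℝ) ^ 2 + (n : ℝ) ^ 2) • Z))) := by
  have e : ∀ w, (1 - EE ((m:ℝ) • Z) w) * (1 - EE ((n:ℝ) • Z) w) = 
    1 - EE ((m:ℝ) • Z) w - EE ((n:ℝ) • Z) w + EE (Real.sqrt ((m : ℝ) ^ 2 + (n : ℝ) ^ 2) • Z) w := by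
    intro w; rw [← EE_mul]; ring
  have nn : ∀ w, 0 ≤ (1 - EE ((m:ℝ) • Z) w) * (1 - EE ((n:ℝ) • Z) w) := fun w =>
    mul_nonneg (by linarith [EE_le ((m:ℝ) • Z) w]) (by linarith [EE_le ((n:ℝ) • Z) w])
  have i1 := EE_int ((m:ℝ) • Z)
  have i2 := EE_int ((n:ℝ) • Z)
  have i3 := EE_int (Real.sqrt ((m : ℝ) ^ 2 + (n : ℝ) ^ 2) • Z)
  have i4 : Integrable (fun _ => (1:ℝ)) (_root_.stdGaussian dw) := integrable_const _
  have hi : ∫ w, (1 - EE ((m:ℝ) • Z) w) * (1 - EE ((n:ℝ) • Z) w) ∂(_root_.stdGaussian dw) = 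
    1 - kb ((m : ℝ) • Z) - kb ((n : ℝ) • Z) + kb (Real.sqrt ((m : ℝ) ^ 2 + (n : ℝ) ^ 2) • Z) := by
    simp_rw [e]
    have j1 : Integrable (fun w => 1 - EE ((m:ℝ) • Z) w) (_root_.stdGaussian dw) := i4.sub i1
    have j2 : Integrable (fun w => 1 - EE ((m:ℝ) • Z) w - EE ((n:ℝ) • Z) w) (_root_.stdGaussian dw) := j1.sub i2
    rw [integral_add j2 i3, integral_sub j1 i2, integral_sub i4 i1]
    simp only [← int_exp_std]
    simp [EE]
  refine ⟨hi ▸ integral_nonneg nn, ?_⟩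
  have e2 : ∀ w, ENNReal.ofReal (cc m * (1 - EE ((m:ℝ) • Z) w)) * ENNReal.ofReal (cc n * (1 - EE ((n:ℝ) • Z) w)) = 
     ENNReal.ofReal (cc m * cc n * ((1 - EE ((m:ℝ) • Z) w) * (1 - EE ((n:ℝ) • Z) w))) := by
    intro w
    rw [← ENNReal.ofReal_mul (mul_nonneg (cc_nonneg m) (by linarith [EE_le ((m:ℝ) • Z) w]))]
    congr 1; ring
  simp_rw [e2]
  rw [← ofReal_integral_eq_lintegral_ofReal, integral_const_mul, hi]
  · refine Integrable.const_mul ?_ _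
    simp_rw [e]
    exact ((i4.sub i1).sub i2).add i3
  · exact Filter.Eventually.of_forall fun w => mul_nonneg (mul_nonneg (cc_nonneg m) (cc_nonneg n)) (nn w)

/-- Joint collision probability of the two bits sharing the left projection:
P(h₁(X) ≠ h₁(Y) ∧ h₂(X) ≠ h₂(Y)) equals the double series in κ_b. -/
theorem joint_hamming_prob {dw dv : ℕ} (hdw : 0 < dw) (hdv : 0 < dv)
    (X Y : Matrix (Fin dw) (Fin dv) ℝ) :
    hashLaw2 dw dv {p | hashBit1 X p ≠ hashBit1 Y p ∧ hashBit2 X p ≠ hashBit2 Y p} =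
      ENNReal.ofReal (64 / π ^ 4 *
        ∑' m : ℕ+, ∑' n : ℕ+,
          (1 - kb ((m : ℝ) • (X - Y)) - kb ((n : ℝ) • (X - Y)) +
              kb (Real.sqrt ((m : ℝ) ^ 2 + (n : ℝ) ^ 2) • (X - Y))) /
            ((4 * (m : ℝ) ^ 2 - 1) * (4 * (n : ℝ) ^ 2 - 1))) := by
  have hfin : hashLaw2 dw dv {p | hashBit1 X p ≠ hashBit1 Y p ∧ hashBit2 X p ≠ hashBit2 Y p} ≠ ⊤ := by
    have : IsProbabilityMeasure (unifIcc (-1) 1) := unifIcc_prob (by norm_num)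
    have : IsProbabilityMeasure (unifIcc 0 (2 * π)) := unifIcc_prob (by positivity)
    have : IsProbabilityMeasure (hashLaw2 dw dv) := by unfold hashLaw2; infer_instance
    exact measure_ne_top _ _
  set Z := X - Y with hZ
  let T : ℕ+ → ℕ+ → ℝ := fun m n => cc m * cc n * (1 - kb ((m : ℝ) • Z) - kb ((n : ℝ) • Z) +
              kb (Real.sqrt ((m : ℝ) ^ 2 + (n : ℝ) ^ 2) • Z))
  have hT : ∀ m n, 0 ≤ T m n := fun m n => 
    mul_nonneg (mul_nonneg (cc_nonneg m) (cc_nonneg n)) (int_w Z m n).1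
  have key : hashLaw2 dw dv {p | hashBit1 X p ≠ hashBit1 Y p ∧ hashBit2 X p ≠ hashBit2 Y p} = 
      ∑' m : ℕ+, ∑' n : ℕ+, ENNReal.ofReal (T m n) := by
    rw [hash_lintegral, ← hZ]
    simp_rw [int_v, ← ENNReal.tsum_mul_right, ← ENNReal.tsum_mul_left]
    have hm : ∀ m : ℕ+, Measurable (fun w => ENNReal.ofReal (cc m * (1 - EE ((m:ℝ) • Z) w))) := by
      intro m
      have := EE_cont ((m:ℝ) • Z)
      exact ENNReal.measurable_ofReal.comp (Continuous.measurable (by fun_prop))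
    rw [lintegral_tsum (fun m => (Measurable.tsum fun n => by
      have := hm m
      have := hm n
      fun_prop).aemeasurable)]
    congr 1; ext m
    rw [lintegral_tsum (fun n => by
      have := hm m
      have := hm n
      fun_prop)]
    congr 1; ext n
    exact (int_w Z m n).2
  rw [key] at hfin ⊢
  have h1 : ∀ m, Summable (T m) := by
    intro m
    have h := ENNReal.ne_top_of_tsum_ne_top hfin m
    have := ENNReal.summable_toReal h
    simpa only [ENNReal.toReal_ofReal (hT _ _)] using this
  have e1 : ∀ m, ∑' n, ENNReal.ofReal (T m n) = ENNReal.ofReal (∑' n, T m n) := fun m =>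
    (ENNReal.ofReal_tsum_of_nonneg (hT m) (h1 m)).symm
  have h0 : ∀ m, 0 ≤ ∑' n, T m n := fun m => tsum_nonneg (hT m)
  simp_rw [e1] at hfin ⊢
  have h2 : Summable (fun m => ∑' n, T m n) := by
    have := ENNReal.summable_toReal hfin
    simpa only [ENNReal.toReal_ofReal (h0 _)] using this
  rw [← ENNReal.ofReal_tsum_of_nonneg h0 h2, ← tsum_mul_left]
  simp_rw [← tsum_mul_left]
  congr 3; ext m; congr 1; ext n
  simp only [T, cc]
  have := den_pos m
  have := den_pos n
  have := Real.pi_ne_zero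
  rw [div_div, div_div, div_mul_div_comm, ← mul_div_assoc, div_mul_eq_mul_div, div_mul_eq_mul_div, div_div]
  congr 1 <;> ring
end
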